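/- Let d = 39028039587479 and let ε be a unit of ℤ[√d] whose image in ℝ is greater than 1 and is minimal among the real images of all units of ℤ[√d] that are greater than 1 (i.e., ε is the fundamental unit of ℤ[√d], which is the full ring of integers of ℚ(√d) since d ≡ 3 mod 4). Then d divides ε.im. -/

import Mathlib

/-- `u + v√d` generates the ideal `(Q, P + √d)` (with `norm = Q`), is congruent to `A + B√d`
modulo `M = d * (10^9+7)`, and has coordinates bounded by `2 ^ e`. -/
def Good (Q P A B : ℤ) (e : ℕ) : Prop :=
  ∃ u v : ℤ, u ^ 2 - 39028039587479 * v ^ 2 = Q ∧ Q ∣ u - P * v ∧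
    39028039587479 * 1000000007 ∣ u - A ∧ 39028039587479 * 1000000007 ∣ v - B ∧
    |u| ≤ 2 ^ e ∧ |v| ≤ 2 ^ e

theorem good_step {Q P A B : ℤ} {e : ℕ} (h : Good Q P A B e) {Q' P' A' B' : ℤ} {e' : ℕ}
    (P2 r s : ℤ) (h1 : Q ∣ P2 - P) (h2 : Q ^ 2 ∣ P2 ^ 2 - 39028039587479)
    (h3 : Q ^ 2 ∣ r + P2 * s) (h4 : r ^ 2 - 39028039587479 * s ^ 2 = Q ^ 2 * Q')
    (h5 : Int.gcd Q' Q = 1) (h6 : Q' ∣ P' ^ 2 - 39028039587479) (h7 : Q' ∣ r - P' * s)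
    (h8 : 39028039587479 * 1000000007 ∣
      Q ^ 2 * A' - ((A ^ 2 + 39028039587479 * B ^ 2) * r + 39028039587479 * (2 * A * B) * s))
    (h9 : 39028039587479 * 1000000007 ∣
      Q ^ 2 * B' - ((A ^ 2 + 39028039587479 * B ^ 2) * s + (2 * A * B) * r))
    (h10 : Int.gcd (39028039587479 * 1000000007) Q = 1)
    (h11 : |r| ≤ 2 ^ 46) (h12 : |s| ≤ 2 ^ 46) (h13 : 1 ≤ Q ^ 2) (he : e' = 2 * e + 100) :
    Good Q' P' A' B' e' := by
  obtain ⟨u, v, hn, hP, hA, hB, hu, hv⟩ := h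
  -- the square
  set w := u ^ 2 + 39028039587479 * v ^ 2 with hw
  set z := 2 * u * v with hz
  have hI : Q ^ 2 ∣ w - P2 * z := by
    have a1 : Q ∣ u - P2 * v := by
      have : u - P2 * v = (u - P * v) - (P2 - P) * v := by ring
      rw [this]; exact dvd_sub hP (h1.mul_right v)
    have : w - P2 * z = (u - P2 * v) ^ 2 - (P2 ^ 2 - 39028039587479) * v ^ 2 := by
      rw [hw, hz]; ring
    rw [this]; exact dvd_sub (pow_dvd_pow_of_dvd a1 2) (h2.mul_right _)
  have hx : Q ^ 2 ∣ w * r + 39028039587479 * z * s := by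
    have : w * r + 39028039587479 * z * s = (w - P2 * z) * r + P2 * z * (r + P2 * s)
      - (P2 ^ 2 - 39028039587479) * (z * s) := by ring
    rw [this]
    exact dvd_sub (dvd_add (hI.mul_right _) (h3.mul_left _)) (h2.mul_right _)
  have hy : Q ^ 2 ∣ w * s + z * r := by
    have : w * s + z * r = (w - P2 * z) * s + z * (r + P2 * s) := by ring
    rw [this]; exact dvd_add (hI.mul_right _) (h3.mul_left _)
  obtain ⟨x, hx⟩ := hx
  obtain ⟨y, hy⟩ := hy
  have hQ0 : Q ^ 2 ≠ 0 := by omega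
  have hnwz : w ^ 2 - 39028039587479 * z ^ 2 = Q ^ 2 := by
    rw [← hn, hw, hz]; ring
  have c5 : IsCoprime Q' (Q ^ 2) := (Int.isCoprime_iff_gcd_eq_one.mpr h5).pow_right
  have c10 : IsCoprime (39028039587479 * 1000000007 : ℤ) (Q ^ 2) :=
    (Int.isCoprime_iff_gcd_eq_one.mpr h10).pow_right
  have hww : 39028039587479 * 1000000007 ∣ w - (A ^ 2 + 39028039587479 * B ^ 2) := by
    have : w - (A ^ 2 + 39028039587479 * B ^ 2)
      = (u - A) * (u + A) + (v - B) * (39028039587479 * (v + B)) := by rw [hw]; ring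
    rw [this]; exact dvd_add (hA.mul_right _) (hB.mul_right _)
  have hzz : 39028039587479 * 1000000007 ∣ z - 2 * A * B := by
    have : z - 2 * A * B = (u - A) * (2 * v) + (v - B) * (2 * A) := by rw [hz]; ring
    rw [this]; exact dvd_add (hA.mul_right _) (hB.mul_right _)
  have habs : |w| ≤ 2 ^ (2 * e + 46) ∧ |z| ≤ 2 ^ (2 * e + 1) := by
    have e1 : |u| * |u| ≤ 2 ^ e * 2 ^ e := mul_le_mul hu hu (abs_nonneg _) (by positivity)
    have e2 : |v| * |v| ≤ 2 ^ e * 2 ^ e := mul_le_mul hv hv (abs_nonneg _) (by positivity)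
    have e3 : |u| * |v| ≤ 2 ^ e * 2 ^ e := mul_le_mul hu hv (abs_nonneg _) (by positivity)
    have e4 : (0 : ℤ) ≤ 2 ^ e * 2 ^ e := by positivity
    have p1 : (2 : ℤ) ^ (2 * e + 46) = 2 ^ e * 2 ^ e * 2 ^ 46 := by ring
    have p2 : (2 : ℤ) ^ (2 * e + 1) = 2 ^ e * 2 ^ e * 2 := by ring
    rw [p1, p2]
    constructor
    · have : |w| = |u| * |u| + 39028039587479 * (|v| * |v|) := by
        rw [abs_mul_abs_self, abs_mul_abs_self, abs_of_nonneg (by positivity)]; rw [hw]; ring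
      rw [this]; linarith
    · have : |z| = 2 * (|u| * |v|) := by rw [hz, abs_mul, abs_mul, abs_two]; ring
      rw [this]; linarith
  obtain ⟨hwb, hzb⟩ := habs
  clear_value w z
  have key : ∀ t N : ℤ, N = Q ^ 2 * t → |N| ≤ 2 ^ e' → |t| ≤ 2 ^ e' := by
    intro t N hN hle
    refine le_trans ?_ hle
    rw [hN, abs_mul, abs_of_nonneg (by positivity : (0 : ℤ) ≤ Q ^ 2)]
    nlinarith [abs_nonneg t]
  have q1 : (0 : ℤ) < 2 ^ (2 * e) := by positivity
  have f1 : |w| * |r| ≤ 2 ^ (2 * e + 46) * 2 ^ 46 := mul_le_mul hwb h11 (abs_nonneg _) (by positivity)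
  have f2 : |w| * |s| ≤ 2 ^ (2 * e + 46) * 2 ^ 46 := mul_le_mul hwb h12 (abs_nonneg _) (by positivity)
  have f3 : |z| * |r| ≤ 2 ^ (2 * e + 1) * 2 ^ 46 := mul_le_mul hzb h11 (abs_nonneg _) (by positivity)
  have f4 : |z| * |s| ≤ 2 ^ (2 * e + 1) * 2 ^ 46 := mul_le_mul hzb h12 (abs_nonneg _) (by positivity)
  have p3 : (2 : ℤ) ^ e' = 2 ^ (2 * e) * 2 ^ 100 := by rw [he, pow_add]
  rw [pow_add] at f1 f2 f3 f4
  refine ⟨x, y, ?_, ?_, ?_, ?_, ?_, ?_⟩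
  · have : (Q ^ 2) ^ 2 * (x ^ 2 - 39028039587479 * y ^ 2) = (Q ^ 2) ^ 2 * Q' := by
      calc (Q ^ 2) ^ 2 * (x ^ 2 - 39028039587479 * y ^ 2)
          = (Q ^ 2 * x) ^ 2 - 39028039587479 * (Q ^ 2 * y) ^ 2 := by ring
        _ = (w ^ 2 - 39028039587479 * z ^ 2) * (r ^ 2 - 39028039587479 * s ^ 2) := by
            rw [← hx, ← hy]; ring
        _ = (Q ^ 2) ^ 2 * Q' := by rw [hnwz, h4]; ring
    exact mul_left_cancel₀ (pow_ne_zero 2 hQ0) this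
  · refine c5.dvd_of_dvd_mul_left ?_
    have : Q ^ 2 * (x - P' * y) = (w - P' * z) * (r - P' * s)
        - (P' ^ 2 - 39028039587479) * (z * s) := by
      rw [mul_sub, ← hx, mul_left_comm, ← hy]; ring
    rw [this]
    exact dvd_sub (h7.mul_left _) (h6.mul_right _)
  · refine c10.dvd_of_dvd_mul_left ?_
    have : Q ^ 2 * (x - A') = (w - (A ^ 2 + 39028039587479 * B ^ 2)) * r
        + (z - 2 * A * B) * (39028039587479 * s) - (Q ^ 2 * A' -
        ((A ^ 2 + 39028039587479 * B ^ 2) * r + 39028039587479 * (2 * A * B) * s)) := by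
      rw [mul_sub, ← hx]; ring
    rw [this]
    exact dvd_sub (dvd_add (hww.mul_right _) (hzz.mul_right _)) h8
  · refine c10.dvd_of_dvd_mul_left ?_
    have : Q ^ 2 * (y - B') = (w - (A ^ 2 + 39028039587479 * B ^ 2)) * s
        + (z - 2 * A * B) * r - (Q ^ 2 * B' -
        ((A ^ 2 + 39028039587479 * B ^ 2) * s + (2 * A * B) * r)) := by
      rw [mul_sub, ← hy]; ring
    rw [this]
    exact dvd_sub (dvd_add (hww.mul_right _) (hzz.mul_right _)) h9
  · refine key x _ hx ?_
    refine (abs_add_le _ _).trans ?_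
    have : |39028039587479 * z * s| = 39028039587479 * (|z| * |s|) := by
      rw [abs_mul, abs_mul]; norm_num; ring
    rw [abs_mul, this, p3]; linarith
  · refine key y _ hy ?_
    refine (abs_add_le _ _).trans ?_
    rw [abs_mul, abs_mul, p3]; linarith

theorem good_0 : Good 6137233 5812625 24789058473 3968 46 :=
  ⟨24789058473, 3968, by norm_num, by norm_num, by norm_num, by norm_num, by norm_num, by norm_num⟩

theorem good_1 : Good 17071885 1695183 39027476383792699959412 39028039860585081017471 192 :=
  good_step good_0 30948058819201 (-27252255741) 1598 (by norm_num) (by norm_num) (by norm_num) (by norm_num)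
    (by norm_num) (by norm_num) (by norm_num) (by norm_num) (by norm_num) (by norm_num)
    (by norm_num) (by norm_num) (by norm_num) (by norm_num)

theorem good_2 : Good 2561821 782140 27943920743372197927192 3942150061084949938294 484 :=
  good_step good_1 152099297888623 (-30831694753) 2286 (by norm_num) (by norm_num) (by norm_num) (by norm_num)
    (by norm_num) (by norm_num) (by norm_num) (by norm_num) (by norm_num) (by norm_num)
    (by norm_num) (by norm_num) (by norm_num) (by norm_num)

theorem good_3 : Good 5931769 139042 7253434997993411653410 37863848764705485699291 1068 :=
  good_step good_2 4941146339563 9398118352 1125 (by norm_num) (by norm_num) (by norm_num) (by norm_num)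
    (by norm_num) (by norm_num) (by norm_num) (by norm_num) (by norm_num) (by norm_num)
    (by norm_num) (by norm_num) (by norm_num) (by norm_num)

theorem good_4 : Good (-2869759) 129813 13232770723941110691467 25483061301055367826049 2236 :=
  good_step good_3 25627591199566 (-5822478400) 1859 (by norm_num) (by norm_num) (by norm_num) (by norm_num)
    (by norm_num) (by norm_num) (by norm_num) (by norm_num) (by norm_num) (by norm_num)
    (by norm_num) (by norm_num) (by norm_num) (by norm_num)

theorem good_5 : Good 4954541 943214 9618221708891266712329 7432312263560424854381 4572 :=
  good_step good_4 4809578465381 27922228910 (-4351) (by norm_num) (by norm_num) (by norm_num) (by norm_num)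
    (by norm_num) (by norm_num) (by norm_num) (by norm_num) (by norm_num) (by norm_num)
    (by norm_num) (by norm_num) (by norm_num) (by norm_num)

theorem good_6 : Good 1325873 1323582 19465678752735245883719 4105488819586997389130 9244 :=
  good_step good_5 16162194275691 8133705157 (-928) (by norm_num) (by norm_num) (by norm_num) (by norm_num)
    (by norm_num) (by norm_num) (by norm_num) (by norm_num) (by norm_num) (by norm_num)
    (by norm_num) (by norm_num) (by norm_num) (by norm_num)

theorem good_7 : Good (-1671191) 1566722 34480470451056536031542 14146552965471164525555 18588 :=
  good_step good_6 1283655875516 5747207069 960 (by norm_num) (by norm_num) (by norm_num) (by norm_num)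
    (by norm_num) (by norm_num) (by norm_num) (by norm_num) (by norm_num) (by norm_num)
    (by norm_num) (by norm_num) (by norm_num) (by norm_num)

theorem good_8 : Good 613969 476417 11586615906127349505764 149422596001801918642 37276 :=
  good_step good_7 1590408864973 (-1384580335) 72 (by norm_num) (by norm_num) (by norm_num) (by norm_num)
    (by norm_num) (by norm_num) (by norm_num) (by norm_num) (by norm_num) (by norm_num)
    (by norm_num) (by norm_num) (by norm_num) (by norm_num)

theorem good_9 : Good (-2987947) 2562654 22086714002204244021788 16603882120104312611306 74652 :=
  good_step good_8 202640944867 (-204303382) (-173) (by norm_num) (by norm_num) (by norm_num) (by norm_num)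
    (by norm_num) (by norm_num) (by norm_num) (by norm_num) (by norm_num) (by norm_num)
    (by norm_num) (by norm_num) (by norm_num) (by norm_num)

theorem good_10 : Good 674413 285324 6392381741250051032325 4557829053430903543429 149404 :=
  good_step good_9 5445703295186 (-3249501846) (-341) (by norm_num) (by norm_num) (by norm_num) (by norm_num)
    (by norm_num) (by norm_num) (by norm_num) (by norm_num) (by norm_num) (by norm_num)
    (by norm_num) (by norm_num) (by norm_num) (by norm_num)

theorem good_11 : Good 5655625 1766098 25954356102041247088351 18948979572870197838912 298908 :=
  good_step good_10 404497016812 (-11457801657) 1816 (by norm_num) (by norm_num) (by norm_num) (by norm_num)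
    (by norm_num) (by norm_num) (by norm_num) (by norm_num) (by norm_num) (by norm_num)
    (by norm_num) (by norm_num) (by norm_num) (by norm_num)

theorem good_12 : Good (-13254739) 13046444 22846228200331331034768 33785940171752930921514 597916 :=
  good_step good_11 3626999323598 (-29769463813) (-5794) (by norm_num) (by norm_num) (by norm_num) (by norm_num)
    (by norm_num) (by norm_num) (by norm_num) (by norm_num) (by norm_num) (by norm_num)
    (by norm_num) (by norm_num) (by norm_num) (by norm_num)

theorem good_13 : Good (-4645271) 867932 1572046421203413447683 312398093474976216231 1195932 :=
  good_step good_12 126946255204041 (-10057892905) 4848 (by norm_num) (by norm_num) (by norm_num) (by norm_num)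
    (by norm_num) (by norm_num) (by norm_num) (by norm_num) (by norm_num) (by norm_num)
    (by norm_num) (by norm_num) (by norm_num) (by norm_num)

theorem good_14 : Good (-2603407) 1437536 38583271481522330338346 35381191553499252698751 2391964 :=
  good_step good_13 17579671281565 4543722632 (-1403) (by norm_num) (by norm_num) (by norm_num) (by norm_num)
    (by norm_num) (by norm_num) (by norm_num) (by norm_num) (by norm_num) (by norm_num)
    (by norm_num) (by norm_num) (by norm_num) (by norm_num)

theorem good_15 : Good (-56827) 7897 25595880046721781852381 4717780402562158224629 4784028 :=
  good_step good_14 4531546333283 (-50761299359) (-8126) (by norm_num) (by norm_num) (by norm_num) (by norm_num)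
    (by norm_num) (by norm_num) (by norm_num) (by norm_num) (by norm_num) (by norm_num)
    (by norm_num) (by norm_num) (by norm_num) (by norm_num)

theorem good_16 : Good 1294045 39548 3254601582335246493836 10833131809077941165373 9568156 :=
  good_step good_15 1213207520 4379794122 (-701) (by norm_num) (by norm_num) (by norm_num) (by norm_num)
    (by norm_num) (by norm_num) (by norm_num) (by norm_num) (by norm_num) (by norm_num)
    (by norm_num) (by norm_num) (by norm_num) (by norm_num)

theorem good_17 : Good (-19514019793739) 19514019793738 18958227851273199063789 17347540993293227533676 19136412 :=
  good_step good_16 6509773 (-19514023048626) 3254887 (by norm_num) (by norm_num) (by norm_num) (by norm_num)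
    (by norm_num) (by norm_num) (by norm_num) (by norm_num) (by norm_num) (by norm_num)
    (by norm_num) (by norm_num) (by norm_num) (by norm_num)

theorem good_18 : Good 1 0 35091843394172211317517 13204315380993926104697 38272924 :=
  good_step good_17 380796968510417970083806381 19514019793740 1 (by norm_num) (by norm_num) (by norm_num) (by norm_num)
    (by norm_num) (by norm_num) (by norm_num) (by norm_num) (by norm_num) (by norm_num)
    (by norm_num) (by norm_num) (by norm_num) (by norm_num)

theorem prime_d : Nat.Prime 39028039587479 := by
  have key : ∀ (x : ZMod 39028039587479) (c : ℕ), x = (c : ZMod 39028039587479) →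
      c % 39028039587479 ≠ 1 → x ≠ 1 := by
    intro x c hx hc h
    rw [h, ← Nat.cast_one, ZMod.natCast_eq_natCast_iff'] at hx
    exact hc hx.symm
  refine lucas_primality _ (13 : ZMod 39028039587479) (by norm_num; reduce_mod_char) ?_
  intro q hq hqd
  have hfac : 39028039587479 - 1 = 2 * 421 * 3187 * 3617 * 4021 := by norm_num
  rw [hfac, hq.dvd_mul, hq.dvd_mul, hq.dvd_mul, hq.dvd_mul,
    Nat.prime_dvd_prime_iff_eq hq (by norm_num), Nat.prime_dvd_prime_iff_eq hq (by norm_num),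
    Nat.prime_dvd_prime_iff_eq hq (by norm_num), Nat.prime_dvd_prime_iff_eq hq (by norm_num),
    Nat.prime_dvd_prime_iff_eq hq (by norm_num)] at hqd
  rcases hqd with (((rfl | rfl) | rfl) | rfl) | rfl
  · exact key _ 39028039587478 (by norm_num; reduce_mod_char) (by norm_num)
  · exact key _ 21998654716238 (by norm_num; reduce_mod_char) (by norm_num)
  · exact key _ 27265201336215 (by norm_num; reduce_mod_char) (by norm_num)
  · exact key _ 23144162197652 (by norm_num; reduce_mod_char) (by norm_num)
  · exact key _ 23854836134359 (by norm_num; reduce_mod_char) (by norm_num)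

/-- A nontrivial solution of the Pell equation whose second coordinate is divisible by `d`. -/
theorem exists_pell : ∃ x y : ℤ, x ^ 2 - 39028039587479 * y ^ 2 = 1 ∧ 39028039587479 ∣ y ∧
    0 ≤ x ∧ 1 ≤ y ∧ x ≤ 2 ^ 38272924 ∧ y ≤ 2 ^ 38272924 := by
  obtain ⟨u, v, h1, -, -, h2, h3, h4⟩ := good_18
  refine ⟨|u|, |v|, by rw [sq_abs, sq_abs]; exact h1, ?_, abs_nonneg _, ?_, h3, h4⟩
  · rw [dvd_abs]
    have := (Dvd.intro _ rfl : (39028039587479 : ℤ) ∣ 39028039587479 * 1000000007).trans h2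
    exact (dvd_sub_left (by norm_num)).1 this
  · refine Int.one_le_abs ?_
    rintro rfl
    revert h2
    norm_num

theorem pow_congr (d : ℤ) (z : ℤ√d) (n : ℕ) :
    d ∣ (z ^ (n + 1)).re - z.re ^ (n + 1) ∧
    d ∣ (z ^ (n + 1)).im - (n + 1) * z.re ^ n * z.im := by
  induction n with
  | zero => simp
  | succ n ih =>
    obtain ⟨⟨a, ha⟩, ⟨b, hb⟩⟩ := ih
    rw [pow_succ z (n + 1), Zsqrtd.re_mul, Zsqrtd.im_mul]
    constructor
    · refine ⟨a * z.re + (z ^ (n + 1)).im * z.im, ?_⟩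
      rw [pow_succ z.re (n + 1)]
      linear_combination z.re * ha
    · refine ⟨a * z.im + b * z.re, ?_⟩
      push_cast
      rw [pow_succ z.re n] at ha ⊢
      linear_combination z.im * ha + z.re * hb

theorem d_dvd_im_of_fundamental_unit
    (ε : (ℤ√(39028039587479 : ℤ))ˣ)
    (hε : 1 < Zsqrtd.toReal (by norm_num) (ε : ℤ√(39028039587479 : ℤ)))
    (hmin : ∀ ζ : (ℤ√(39028039587479 : ℤ))ˣ,
        1 < Zsqrtd.toReal (by norm_num) (ζ : ℤ√(39028039587479 : ℤ)) →
        Zsqrtd.toReal (by norm_num) (ε : ℤ√(39028039587479 : ℤ)) ≤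
          Zsqrtd.toReal (by norm_num) (ζ : ℤ√(39028039587479 : ℤ))) :
    (39028039587479 : ℤ) ∣ (ε : ℤ√(39028039587479 : ℤ)).im := by
  have hpr : Prime (39028039587479 : ℤ) := by
    have := Nat.prime_iff_prime_int.1 prime_d
    exact_mod_cast this
  have h0 : (0 : ℤ) ≤ 39028039587479 := by norm_num
  have hinj : Function.Injective (Zsqrtd.toReal h0) := by
    refine Zsqrtd.toReal_injective h0 ?_
    intro n hn
    have : (39028039587479 : ℤ) ∣ n * n := ⟨1, by omega⟩
    have hd : (39028039587479 : ℤ) ∣ n := (hpr.dvd_or_dvd this).elim id id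
    obtain ⟨c, rfl⟩ := hd
    have : (39028039587479 : ℤ) * (39028039587479 * (c * c)) = 39028039587479 * 1 := by
      linarith
    have := mul_left_cancel₀ (by norm_num) this
    omega
  have hval : ∀ z : ℤ√(39028039587479 : ℤ), Zsqrtd.toReal h0 z
      = z.re + z.im * √((39028039587479 : ℤ) : ℝ) := fun z => by
    rw [Zsqrtd.toReal_apply]
  set t : ℝ := √((39028039587479 : ℤ) : ℝ) with ht
  have htt : t * t = 39028039587479 := by
    rw [ht, Real.mul_self_sqrt (by norm_num)]; norm_num
  have ht0 : 0 ≤ t := Real.sqrt_nonneg _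
  have ht1 : 2 ≤ t := by nlinarith
  have ht2 : t ≤ 2 ^ 23 - 1 := by nlinarith
  clear_value t
  set φ := Zsqrtd.toReal h0 with hφ
  -- the norm of ε
  have hne : (ε : ℤ√(39028039587479 : ℤ)).re ^ 2 - 39028039587479 *
      (ε : ℤ√(39028039587479 : ℤ)).im ^ 2 = 1 ∨ (ε : ℤ√(39028039587479 : ℤ)).re ^ 2 -
      39028039587479 * (ε : ℤ√(39028039587479 : ℤ)).im ^ 2 = -1 := by
    have := Zsqrtd.norm_eq_one_iff.2 ε.isUnit
    rw [Zsqrtd.norm_def] at this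
    rcases Int.natAbs_eq_iff.1 this with h | h
    · left; push_cast at h; linarith
    · right; push_cast at h; linarith
  -- ε is at least two
  have hε2 : 2 ≤ φ (ε : ℤ√(39028039587479 : ℤ)) := by
    have hε' : 1 < φ (ε : ℤ√(39028039587479 : ℤ)) := hε
    rw [hval] at hε' ⊢
    generalize (ε : ℤ√(39028039587479 : ℤ)).re = a at *
    generalize (ε : ℤ√(39028039587479 : ℤ)).im = b at *
    have hb : b ≠ 0 := by
      rintro rfl
      have ha : (1 : ℤ) < a := by
        simp only [Int.cast_zero, zero_mul, add_zero] at hε'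
        exact_mod_cast hε'
      rcases hne with h | h <;> nlinarith
    have hr : ((a : ℝ) + b * t) * (a - b * t) = 1 ∨ ((a : ℝ) + b * t) * (a - b * t) = -1 := by
      have e : ((a : ℝ) + b * t) * (a - b * t) = ((a ^ 2 - 39028039587479 * b ^ 2 : ℤ) : ℝ) := by
        push_cast; linear_combination (-(b : ℝ) ^ 2) * htt
      rw [e]
      rcases hne with h | h <;> rw [h] <;> simp
    have hc : |(a : ℝ) - b * t| ≤ 1 := by
      have : |(a : ℝ) + b * t| * |(a : ℝ) - b * t| = 1 := by
        rw [← abs_mul]; rcases hr with h | h <;> rw [h] <;> simp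
      rw [abs_of_pos (by linarith : 0 < (a : ℝ) + b * t)] at this
      nlinarith [abs_nonneg ((a : ℝ) - b * t)]
    rw [abs_le] at hc
    rcases lt_or_gt_of_ne hb with h | h
    · have : (b : ℝ) ≤ -1 := by exact_mod_cast (by omega : b ≤ -1)
      nlinarith
    · have : (1 : ℝ) ≤ b := by exact_mod_cast h
      nlinarith
  obtain ⟨x, y, hxy, hdy, hx0, hy1, hxb, hyb⟩ := exists_pell
  have hunit : IsUnit (⟨x, y⟩ : ℤ√(39028039587479 : ℤ)) := by
    rw [← Zsqrtd.norm_eq_one_iff, Zsqrtd.norm_def]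
    have : x * x - 39028039587479 * y * y = 1 := by linarith
    simp only [this]; rfl
  obtain ⟨η, hη⟩ := hunit
  have hη1 : 1 < φ (η : ℤ√(39028039587479 : ℤ)) := by
    rw [hη, hval]
    have a1 : (0 : ℝ) ≤ x := by exact_mod_cast hx0
    have a2 : (1 : ℝ) ≤ y := by exact_mod_cast hy1
    simp only
    nlinarith
  have hηb : φ (η : ℤ√(39028039587479 : ℤ)) ≤ 2 ^ (38272924 + 23) := by
    rw [hη, hval]
    have a1 : (x : ℝ) ≤ 2 ^ 38272924 := by exact_mod_cast hxb
    have a2 : (y : ℝ) ≤ 2 ^ 38272924 := by exact_mod_cast hyb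
    simp only
    rw [pow_add]
    generalize (2 : ℝ) ^ 38272924 = T at a1 a2 ⊢
    have a3 : (1 : ℝ) ≤ y := by exact_mod_cast hy1
    nlinarith
  have hε1 : 1 < φ (ε : ℤ√(39028039587479 : ℤ)) := hε
  obtain ⟨n, hn1, hn2⟩ := exists_nat_pow_near hη1.le hε1
  have hpos : 0 < φ (ε : ℤ√(39028039587479 : ℤ)) ^ n := by positivity
  have hζ : φ ((η * (ε⁻¹) ^ n : (ℤ√(39028039587479 : ℤ))ˣ) : ℤ√(39028039587479 : ℤ)) *
      φ (ε : ℤ√(39028039587479 : ℤ)) ^ n = φ (η : ℤ√(39028039587479 : ℤ)) := by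
    rw [← map_pow, ← map_mul, ← Units.val_pow_eq_pow_val, ← Units.val_mul]
    congr 2
    rw [mul_assoc, ← mul_pow]; simp
  have hle : ¬ 1 < φ ((η * (ε⁻¹) ^ n : (ℤ√(39028039587479 : ℤ))ˣ) : ℤ√(39028039587479 : ℤ)) := by
    intro h
    have h' : φ (ε : ℤ√(39028039587479 : ℤ)) ≤ _ := hmin _ h
    have := mul_le_mul_of_nonneg_right h' hpos.le
    rw [hζ, ← pow_succ'] at this
    linarith
  have heq : (η : ℤ√(39028039587479 : ℤ)) = (ε : ℤ√(39028039587479 : ℤ)) ^ n := by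
    apply hinj
    rw [map_pow]
    refine le_antisymm ?_ hn1
    rw [← hζ]
    have := mul_le_mul_of_nonneg_right (not_lt.1 hle) hpos.le
    rwa [one_mul] at this
  rcases n with _ | n
  · rw [heq] at hη1; simp at hη1
  have him := (pow_congr _ (ε : ℤ√(39028039587479 : ℤ)) n).2
  rw [← heq, hη] at him
  have him2 := (dvd_sub_right hdy).1 him
  rcases hpr.dvd_or_dvd him2 with h | h
  · exfalso
    rcases hpr.dvd_or_dvd h with h | h
    · have hge : 39028039587479 ≤ n + 1 := by
        have := Int.le_of_dvd (by omega) h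
        omega
      have b1 : (2 : ℝ) ^ (n + 1) ≤ φ (ε : ℤ√(39028039587479 : ℤ)) ^ (n + 1) :=
        pow_le_pow_left₀ (by norm_num) hε2 _
      have b2 : (2 : ℝ) ^ (n + 1) ≤ 2 ^ (38272924 + 23) := b1.trans (hn1.trans hηb)
      have b3 := (pow_le_pow_iff_right₀ (by norm_num : (1 : ℝ) < 2)).1 b2
      omega
    · have h' := hpr.dvd_of_dvd_pow h
      have h2 : (39028039587479 : ℤ) ∣ (ε : ℤ√(39028039587479 : ℤ)).re ^ 2 - 39028039587479 *
          (ε : ℤ√(39028039587479 : ℤ)).im ^ 2 :=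
        dvd_sub (dvd_pow h' two_ne_zero) (dvd_mul_right _ _)
      rcases hne with h | h <;> rw [h] at h2 <;> norm_num at h2
  · exact h
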